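/- For every n ≥ 0 and every defect-0 β-pair (A,B) of rank n, the pair Θ'(A,B) belongs to X̃_{2n+1} and has defect 1; moreover Θ' is compatible with shifts (Θ' applied to the 1-shift of (A,B) equals the 1-shift of Θ'(A,B) in the 𝕏-family) and induces a well-defined bijection from 𝕍_n^0 onto 𝕏_{2n+1}^1. -/

import Mathlib

namespace CSpaper

/-- The rank of a β-set: the sum of its elements minus `choose (card) 2`. -/
def bRank (B : Finset ℕ) : ℤ :=
  (∑ b ∈ B, (b : ℤ)) - (B.card.choose 2 : ℤ)

/-- The `k`-th shift of a β-set: `{0,…,k-1} ∪ {b+k : b ∈ B}`. -/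
def bShift (k : ℕ) (B : Finset ℕ) : Finset ℕ :=
  Finset.range k ∪ B.image (· + k)

/-- Shift-equivalence of β-sets. -/
def sEquiv (A B : Finset ℕ) : Prop :=
  ∃ k, bShift k A = B ∨ A = bShift k B

/-- A β-pair: an ordered pair of β-sets. -/
abbrev BPair := Finset ℕ × Finset ℕ

/-- The defect of a β-pair. -/
def pDefect (Λ : BPair) : ℤ := (Λ.1.card : ℤ) - (Λ.2.card : ℤ)

/-- The rank of a β-pair: `rk A + rk B + ⌊(d/2)²⌋`. -/
def pRank (Λ : BPair) : ℤ := bRank Λ.1 + bRank Λ.2 + pDefect Λ ^ 2 / 4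

/-- The `k`-th shift of a β-pair. -/
def pShift (k : ℕ) (Λ : BPair) : BPair := (bShift k Λ.1, bShift k Λ.2)

/-- Shift-equivalence of β-pairs: one is a shift of the other. -/
def pEquiv (Λ Ξ : BPair) : Prop := ∃ k, pShift k Λ = Ξ ∨ Λ = pShift k Ξ

/-- `Λ` is a representative of a symbol in `𝕍_N^d`. -/
def inV (N d : ℤ) (Λ : BPair) : Prop := pRank Λ = N ∧ pDefect Λ = d

/-- The `i`-th smallest element of a finite set of naturals (0-indexed). -/
def nthEl (A : Finset ℕ) (i : ℕ) : ℕ := (A.sort (· ≤ ·)).getD i 0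

/-- The operation `A ⊙ B = {a_1+b_1, a_2+b_2-1, …, a_s+b_s-(s-1)}` (0-indexed:
`a_i + b_i - i`). -/
def odot (A B : Finset ℕ) : Finset ℕ :=
  (Finset.range A.card).image fun i => nthEl A i + nthEl B i - i

/-- Dominance order `B ⊴ A`: every tail sum of `B` is at most the corresponding
tail sum of `A`. -/
def domLE (B A : Finset ℕ) : Prop :=
  ∀ k, ∑ i ∈ Finset.Ico k B.card, nthEl B i ≤ ∑ i ∈ Finset.Ico k A.card, nthEl A i

/-- No two consecutive integers. -/
def noConsec (S : Finset ℕ) : Prop := ∀ x ∈ S, x + 1 ∉ S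

/-- `{0,2,…,2k-2} ∪ {x+2k : x ∈ S}`. -/
def evShift (k : ℕ) (S : Finset ℕ) : Finset ℕ :=
  (Finset.range k).image (fun i => 2 * i) ∪ S.image (· + 2 * k)

/-- `{1,3,…,2k-1} ∪ {y+2k : y ∈ S}`. -/
def odShift (k : ℕ) (S : Finset ℕ) : Finset ℕ :=
  (Finset.range k).image (fun i => 2 * i + 1) ∪ S.image (· + 2 * k)

/-- The `k`-th shift in the 𝕐-family. -/
def yShift (k : ℕ) (P : BPair) : BPair := (evShift k P.1, odShift k P.2)

/-- The `k`-th shift in the 𝕏-family. -/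
def xShift (k : ℕ) (P : BPair) : BPair := (evShift k P.1, evShift k P.2)

/-- Shift-equivalence in the 𝕐-family. -/
def yEquiv (P Q : BPair) : Prop := ∃ k, yShift k P = Q ∨ P = yShift k Q

/-- Shift-equivalence in the 𝕏-family (unordered pairs, so swaps are allowed). -/
def xEquiv (P Q : BPair) : Prop :=
  ∃ k, xShift k P = Q ∨ xShift k P = Q.swap ∨ P = xShift k Q ∨ P.swap = xShift k Q

/-- Membership in `Ỹ_N`. -/
def inYtilde (N : ℤ) (P : BPair) : Prop :=
  (∀ y ∈ P.2, 0 < y) ∧ Odd (P.1.card + P.2.card) ∧ noConsec P.1 ∧ noConsec P.2 ∧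
    2 * ((∑ x ∈ P.1, (x : ℤ)) + ∑ y ∈ P.2, (y : ℤ)) =
      N + ((P.1.card + P.2.card : ℕ) : ℤ) * (((P.1.card + P.2.card : ℕ) : ℤ) - 1)

/-- The defect in the 𝕐-family: `|X| - |Y|`. -/
def yDefect (P : BPair) : ℤ := (P.1.card : ℤ) - (P.2.card : ℤ)

/-- Membership in `X̃_N`. -/
def inXtilde (N : ℤ) (P : BPair) : Prop :=
  noConsec P.1 ∧ noConsec P.2 ∧
    2 * ((∑ x ∈ P.1, (x : ℤ)) + ∑ y ∈ P.2, (y : ℤ)) =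
      N + (((P.1.card + P.2.card : ℕ) : ℤ) - 1) ^ 2 - 1

/-- The defect in the 𝕏-family: `||A| - |B||`. -/
def xDefect (P : BPair) : ℤ := |(P.1.card : ℤ) - (P.2.card : ℤ)|

/-- The map `Θ(A,B) = ({0, a_1+2, …, a_s+s+1}, {b_1+1, …, b_s+s})`. -/
def theta (Λ : BPair) : BPair :=
  (insert 0 ((Finset.range Λ.1.card).image fun i => nthEl Λ.1 i + i + 2),
   (Finset.range Λ.2.card).image fun i => nthEl Λ.2 i + i + 1)

/-- The map `Θ'(A,B) = ({0, a_1+2, …, a_s+s+1}, {b_1, …, b_s+s-1})`. -/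
def theta' (Λ : BPair) : BPair :=
  (insert 0 ((Finset.range Λ.1.card).image fun i => nthEl Λ.1 i + i + 2),
   (Finset.range Λ.2.card).image fun i => nthEl Λ.2 i + i)

/-- The map `Θ̄(A,B) = ({a_1, …, a_s+s-1}, {b_1, …, b_s+s-1})`. -/
def thetaBar (Λ : BPair) : BPair :=
  ((Finset.range Λ.1.card).image fun i => nthEl Λ.1 i + i,
   (Finset.range Λ.2.card).image fun i => nthEl Λ.2 i + i)

/-- `ᵀΘ(A,B) = Θ(B,A)`. -/
def thetaT (Λ : BPair) : BPair := theta (Λ.2, Λ.1)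

/-- `Π^d` for `d ≥ 1`: adjoin `{0,2,…,2d-4}` to the first row and add `2d-2`
to its entries. -/
def piPos (d : ℕ) (P : BPair) : BPair := (evShift (d - 1) P.1, P.2)

/-- `Π^d` for `d = -e ≤ -1`: adjoin `{1,3,…,2e+1}` to the second row and add
`2e+2` to its entries. -/
def piNeg (e : ℕ) (P : BPair) : BPair := (P.1, odShift (e + 1) P.2)

/-- `Δ_B^t = Π^{2t+1} ∘ Θ'`. -/
def deltaB (t : ℕ) (Λ : BPair) : BPair := piPos (2 * t + 1) (theta' Λ)

/-- `Δ_C^t = Π^{4t+1} ∘ Θ`. -/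
def deltaC (t : ℕ) (Λ : BPair) : BPair := piPos (4 * t + 1) (theta Λ)

/-- `Δ_{C'}^t = Π^{1-4t} ∘ ᵀΘ` (for `t ≥ 1`). -/
def deltaC' (t : ℕ) (Λ : BPair) : BPair := piNeg (4 * t - 1) (thetaT Λ)

/-- `Δ_D^t = Π^{4t} ∘ Θ'` (for `t ≥ 1`). -/
def deltaD (t : ℕ) (Λ : BPair) : BPair := piPos (4 * t) (theta' Λ)

/-- `Δ_D^0 = Θ̄`. -/
def deltaD0 (Λ : BPair) : BPair := thetaBar Λ

/-- All entries of a pair (with multiplicity) in weakly increasing order. -/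
def entries (P : BPair) : List ℕ := (P.1.val + P.2.val).sort (· ≤ ·)

/-- `Σ_j (len-1-j) ⬝ (L[j] - ref j)`, the common shape of `a`, `b` and `σ`. -/
def wsum (L : List ℕ) (ref : ℕ → ℕ) : ℤ :=
  ∑ j ∈ Finset.range L.length,
    ((L.length - 1 - j : ℕ) : ℤ) * ((L.getD j 0 : ℤ) - (ref j : ℤ))

/-- Lusztig's a-function (reference sequence `0,0,1,1,…`). -/
def aFun (P : BPair) : ℤ := wsum (entries P) (fun j => j / 2)

/-- Lusztig's b-function with the 𝕏-reference sequence `0,0,2,2,…`. -/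
def bX (P : BPair) : ℤ := wsum (entries P) (fun j => 2 * (j / 2))

/-- Lusztig's b-function with the 𝕐-reference sequence `0,1,2,…`. -/
def bY (P : BPair) : ℤ := wsum (entries P) (fun j => j)

/-- `σ(Λ) = Σ (2k-i)·x_i`. -/
def sigmaFun (P : BPair) : ℤ := wsum (entries P) (fun _ => 0)

/-- Entrywise sum of two rows (of equal size), sorted positions added. -/
def addRows (X X' : Finset ℕ) : Finset ℕ :=
  (Finset.range X.card).image fun i => nthEl X i + nthEl X' i

/-- `Λ ⊕ Ξ` in the types B and D cases. -/
def oplus (Λ Ξ : BPair) : BPair := (addRows Λ.1 Ξ.1, addRows Λ.2 Ξ.2)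

/-- `Λ ⊕ Ξ` in the type C case. -/
def oplusC (Λ Ξ : BPair) : BPair :=
  (insert (nthEl Ξ.1 0)
      ((Finset.range Λ.1.card).image fun i => nthEl Λ.1 i + nthEl Ξ.1 (i + 1) + 1),
   (Finset.range Λ.2.card).image fun j => nthEl Λ.2 j + nthEl Ξ.2 j + 1)

/-- `Λ ⊞ Ξ`: the twisted combination in type D. -/
def boxplus (Λ Ξ : BPair) : BPair := (addRows Λ.2 Ξ.1, addRows Λ.1 Ξ.2)

/-- Similarity of β-pairs: after shifts, the row unions and row intersections
coincide. -/
def pSimilar (Λ Ξ : BPair) : Prop :=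
  ∃ j k, (pShift j Λ).1 ∪ (pShift j Λ).2 = (pShift k Ξ).1 ∪ (pShift k Ξ).2 ∧
    (pShift j Λ).1 ∩ (pShift j Λ).2 = (pShift k Ξ).1 ∩ (pShift k Ξ).2

/-- Similarity in the 𝕏-family: after 𝕏-shifts, the row unions and
intersections coincide. -/
def xSimilar (P Q : BPair) : Prop :=
  ∃ j k, (xShift j P).1 ∪ (xShift j P).2 = (xShift k Q).1 ∪ (xShift k Q).2 ∧
    (xShift j P).1 ∩ (xShift j P).2 = (xShift k Q).1 ∩ (xShift k Q).2

/-- A β-pair is reduced if it is not a proper shift, i.e. `0` does not lie in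
both rows; each shift-equivalence class has a unique reduced representative. -/
def reduced (Λ : BPair) : Prop := ¬ (0 ∈ Λ.1 ∧ 0 ∈ Λ.2)

/-- `a(Λ) + a(Ξ) = b(Λ⊕Ξ)`, computed (as in the paper) on shift-representatives
with matching row sizes. -/
def minimalPair (Λ Ξ : BPair) : Prop :=
  ∃ Λ' Ξ', pEquiv Λ Λ' ∧ pEquiv Ξ Ξ' ∧ Λ'.1.card = Ξ'.1.card ∧
    Λ'.2.card = Ξ'.2.card ∧ aFun Λ' + aFun Ξ' = bX (oplus Λ' Ξ')

/-- The generating relation `i ≈ i+1` whenever `c_i = c_{i+1}` or `d_i = d_{i+1}`. -/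
def linkRel (n : ℕ) (c d : ℕ → ℕ) (i j : Fin n) : Prop :=
  (j : ℕ) = (i : ℕ) + 1 ∧ (c i = c j ∨ d i = d j)

/-- The equivalence relation generated by `linkRel`. -/
def idxSetoid (n : ℕ) (c d : ℕ → ℕ) : Setoid (Fin n) :=
  ⟨Relation.EqvGen (linkRel n c d), Relation.EqvGen.is_equivalence _⟩

/-- A degenerate equivalence class: `{i, i+1}` with `c_i = c_{i+1}` and
`d_i = d_{i+1}`. -/
def degenClass (n : ℕ) (c d : ℕ → ℕ) (Q : Quotient (idxSetoid n c d)) : Prop :=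
  ∃ i j : Fin n, (j : ℕ) = (i : ℕ) + 1 ∧ c i = c j ∧ d i = d j ∧
    Q = Quotient.mk (idxSetoid n c d) i ∧
    ∀ m : Fin n, Quotient.mk (idxSetoid n c d) m = Q → m = i ∨ m = j

/-- The number `ℓ` of non-degenerate equivalence classes. -/
noncomputable def ellCount (n : ℕ) (c d : ℕ → ℕ) : ℕ :=
  Nat.card {Q : Quotient (idxSetoid n c d) // ¬ degenClass n c d Q}

/-- `Ξ` is obtained from `Λ` by decreasing a single entry by `1`, the result
again being a β-pair. -/
def stepDown (Λ Ξ : BPair) : Prop :=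
  (∃ x ∈ Λ.1, 0 < x ∧ x - 1 ∉ Λ.1 ∧ Ξ = (insert (x - 1) (Λ.1.erase x), Λ.2)) ∨
  (∃ x ∈ Λ.2, 0 < x ∧ x - 1 ∉ Λ.2 ∧ Ξ = (Λ.1, insert (x - 1) (Λ.2.erase x)))

/-- The number of elements of `A` below `a`. -/
def cntBelow (A : Finset ℕ) (a : ℕ) : ℕ := (A.filter (· < a)).card

/-- `{a_1, a_2 + 1, …, a_s + s - 1}`. -/
def spread (A : Finset ℕ) : Finset ℕ := A.image fun a => a + cntBelow A a

/-- `{a_1, a_2 - 1, …, a_s - (s - 1)}`. -/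
def compress (A : Finset ℕ) : Finset ℕ := A.image fun a => a - cntBelow A a

lemma nthEl_eq_orderEmbOfFin (A : Finset ℕ) (i : Fin A.card) :
    nthEl A i = A.orderEmbOfFin rfl i := by
  rw [Finset.orderEmbOfFin_apply, nthEl, List.getD_eq_getElem _ _ (by simp)]
  rfl

lemma cntBelow_orderEmbOfFin (A : Finset ℕ) (i : Fin A.card) :
    cntBelow A (A.orderEmbOfFin rfl i) = i := by
  have h : A.filter (· < A.orderEmbOfFin rfl i) =
      (Finset.univ.filter (· < i)).image (A.orderEmbOfFin rfl) := by
    ext x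
    simp only [Finset.mem_filter, Finset.mem_image, Finset.mem_univ, true_and]
    constructor
    · rintro ⟨hx, hlt⟩
      rw [← Finset.mem_coe, ← Finset.range_orderEmbOfFin A rfl] at hx
      obtain ⟨j, rfl⟩ := hx
      exact ⟨j, by simpa using hlt, rfl⟩
    · rintro ⟨j, hj, rfl⟩
      exact ⟨Finset.orderEmbOfFin_mem _ _ _, by simpa using hj⟩
  rw [cntBelow, h, Finset.card_image_of_injective _ (A.orderEmbOfFin rfl).injective,
    Finset.filter_gt_eq_Iio, Fin.card_Iio]

lemma image_nthEl (A : Finset ℕ) (g : ℕ → ℕ → ℕ) :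
    ((Finset.range A.card).image fun i => g (nthEl A i) i) =
      A.image fun a => g a (cntBelow A a) := by
  ext x
  simp only [Finset.mem_image, Finset.mem_range]
  constructor
  · rintro ⟨i, hi, rfl⟩
    refine ⟨A.orderEmbOfFin rfl ⟨i, hi⟩, Finset.orderEmbOfFin_mem _ _ _, ?_⟩
    rw [cntBelow_orderEmbOfFin, ← nthEl_eq_orderEmbOfFin]
  · rintro ⟨a, ha, rfl⟩
    rw [← Finset.mem_coe, ← Finset.range_orderEmbOfFin A rfl] at ha
    obtain ⟨j, rfl⟩ := ha
    exact ⟨j, j.2, by rw [cntBelow_orderEmbOfFin, ← nthEl_eq_orderEmbOfFin]⟩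

lemma cntBelow_mono (A : Finset ℕ) : Monotone (cntBelow A) := fun _ _ h =>
  Finset.card_le_card (Finset.monotone_filter_right _ fun _ _ hx => lt_of_lt_of_le hx h)

lemma cntBelow_lt {A : Finset ℕ} {a b : ℕ} (ha : a ∈ A) (h : a < b) :
    cntBelow A a < cntBelow A b := by
  refine Finset.card_lt_card (Finset.ssubset_iff_of_subset ?_ |>.2 ⟨a, by simp [ha, h], by simp⟩)
  exact Finset.monotone_filter_right _ fun _ _ hx => lt_trans hx h

lemma cntBelow_le (A : Finset ℕ) (a : ℕ) : cntBelow A a ≤ a := by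
  have : A.filter (· < a) ⊆ Finset.range a := fun x hx => by simp_all
  simpa [cntBelow] using Finset.card_le_card this

lemma cntBelow_image {A : Finset ℕ} {f : ℕ → ℕ} (hf : StrictMonoOn f A) {a : ℕ} (ha : a ∈ A) :
    cntBelow (A.image f) (f a) = cntBelow A a := by
  have h : (A.image f).filter (· < f a) = (A.filter (· < a)).image f := by
    ext x
    simp only [Finset.mem_filter, Finset.mem_image]
    constructor
    · rintro ⟨⟨b, hb, rfl⟩, hlt⟩
      exact ⟨b, ⟨hb, (hf.lt_iff_lt hb ha).1 hlt⟩, rfl⟩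
    · rintro ⟨b, ⟨hb, hlt⟩, rfl⟩
      exact ⟨⟨b, hb, rfl⟩, hf hb ha hlt⟩
  rw [cntBelow, h, Finset.card_image_of_injOn, cntBelow]
  exact hf.injOn.mono fun x hx => (Finset.mem_filter.1 hx).1

lemma strictMono_add_cntBelow (A : Finset ℕ) : StrictMono fun a => a + cntBelow A a :=
  fun _ _ h => add_lt_add_of_lt_of_le h (cntBelow_mono A h.le)

lemma card_spread (A : Finset ℕ) : (spread A).card = A.card :=
  Finset.card_image_of_injective _ (strictMono_add_cntBelow A).injective

lemma compress_spread (A : Finset ℕ) : compress (spread A) = A := by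
  rw [compress, spread, Finset.image_image]
  conv_rhs => rw [← Finset.image_id (s := A)]
  refine Finset.image_congr fun a ha => ?_
  simp only [Function.comp, id]
  rw [cntBelow_image ((strictMono_add_cntBelow A).strictMonoOn _) ha]
  omega

lemma spread_injective : Function.Injective spread :=
  Function.LeftInverse.injective compress_spread

lemma noConsec_spread (A : Finset ℕ) : noConsec (spread A) := by
  intro x hx hx'
  simp only [spread, Finset.mem_image] at hx hx'
  obtain ⟨a, ha, rfl⟩ := hx
  obtain ⟨b, hb, h⟩ := hx'
  have hab : a < b := (strictMono_add_cntBelow A).lt_iff_lt.1 (by omega)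
  have := cntBelow_lt ha hab
  omega

lemma noConsec.cntBelow_add_lt {S : Finset ℕ} (hS : noConsec S) {s t : ℕ} (hs : s ∈ S)
    (ht : t ∈ S) (h : s < t) : cntBelow S t + s < cntBelow S s + t := by
  have hne : t ≠ s + 1 := fun e => hS s hs (e ▸ ht)
  have hsub : S.filter (· < t) ⊆ S.filter (· < s) ∪ (Finset.Ico s t).erase (s + 1) := by
    intro x hx
    simp only [Finset.mem_union, Finset.mem_filter, Finset.mem_erase, Finset.mem_Ico] at hx ⊢
    have : x ≠ s + 1 := fun e => hS s hs (e ▸ hx.1)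
    by_cases hxs : x < s
    · exact Or.inl ⟨hx.1, hxs⟩
    · exact Or.inr ⟨this, by omega, hx.2⟩
  have h1 := (Finset.card_le_card hsub).trans (Finset.card_union_le _ _)
  rw [Finset.card_erase_of_mem (by simp; omega), Nat.card_Ico] at h1
  simp only [cntBelow]
  omega

lemma noConsec.strictMonoOn_sub {S : Finset ℕ} (hS : noConsec S) :
    StrictMonoOn (fun s => s - cntBelow S s) S := by
  intro s hs t ht h
  have := hS.cntBelow_add_lt hs ht h
  have := cntBelow_le S s
  have := cntBelow_le S t
  simp only
  omega

lemma noConsec.spread_compress {S : Finset ℕ} (hS : noConsec S) : spread (compress S) = S := by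
  rw [compress, spread, Finset.image_image]
  conv_rhs => rw [← Finset.image_id (s := S)]
  refine Finset.image_congr fun a ha => ?_
  simp only [Function.comp, id]
  rw [cntBelow_image hS.strictMonoOn_sub ha]
  have := cntBelow_le S a
  omega

lemma sum_spread (A : Finset ℕ) :
    ∑ x ∈ spread A, (x : ℤ) = ∑ a ∈ A, (a : ℤ) + (A.card.choose 2 : ℤ) := by
  rw [spread, Finset.sum_image (strictMono_add_cntBelow A).injective.injOn]
  push_cast
  rw [Finset.sum_add_distrib]
  congr 1
  have hinj : Set.InjOn (cntBelow A) A :=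
    StrictMonoOn.injOn fun _ ha _ _ h => cntBelow_lt ha h
  have himg : A.image (cntBelow A) = Finset.range A.card := by
    rw [← image_nthEl A fun _ i => i, Finset.image_id']
  rw [Nat.choose_two_right, ← Finset.sum_range_id, ← himg, Finset.sum_image hinj]
  push_cast
  rfl

lemma mem_evShift {k : ℕ} {S : Finset ℕ} {x : ℕ} :
    x ∈ evShift k S ↔ (∃ i < k, 2 * i = x) ∨ ∃ s ∈ S, s + 2 * k = x := by
  simp [evShift]

lemma evShift_one (S : Finset ℕ) : evShift 1 S = insert 0 (S.image (· + 2)) := by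
  simp [evShift]

lemma card_evShift (k : ℕ) (S : Finset ℕ) : (evShift k S).card = k + S.card := by
  rw [evShift, Finset.card_union_of_disjoint, Finset.card_image_of_injective,
    Finset.card_image_of_injective, Finset.card_range]
  · exact add_left_injective _
  · exact fun a b h => by simpa using h
  · simp only [Finset.disjoint_left, Finset.mem_image, Finset.mem_range]
    rintro x ⟨i, hi, rfl⟩ ⟨s, -, h⟩
    omega

lemma sum_evShift_one (S : Finset ℕ) :
    ∑ x ∈ evShift 1 S, (x : ℤ) = ∑ x ∈ S, (x : ℤ) + 2 * S.card := by
  rw [evShift_one, Finset.sum_insert (by simp), Finset.sum_image (add_left_injective _).injOn]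
  push_cast
  rw [Finset.sum_add_distrib]
  simp [mul_comm]

lemma noConsec.evShift_one {S : Finset ℕ} (hS : noConsec S) : noConsec (evShift 1 S) := by
  intro x hx hx'
  rw [mem_evShift] at hx hx'
  rcases hx with ⟨i, hi, rfl⟩ | ⟨s, hs, rfl⟩ <;> rcases hx' with ⟨j, hj, h⟩ | ⟨t, ht, h⟩
  · omega
  · omega
  · omega
  · exact hS s hs ((by omega : t = s + 1) ▸ ht)

lemma evShift_evShift_comm (j k : ℕ) (S : Finset ℕ) :
    evShift j (evShift k S) = evShift k (evShift j S) := by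
  have key (j k : ℕ) : evShift j (evShift k S) = evShift (j + k) S := by
    ext x
    simp only [mem_evShift]
    constructor
    · rintro (⟨i, hi, rfl⟩ | ⟨_, ⟨i, hi, rfl⟩ | ⟨s, hs, rfl⟩, rfl⟩)
      · exact Or.inl ⟨i, by omega, rfl⟩
      · exact Or.inl ⟨i + j, by omega, by ring⟩
      · exact Or.inr ⟨s, hs, by ring⟩
    · rintro (⟨i, hi, rfl⟩ | ⟨s, hs, rfl⟩)
      · by_cases h : i < j
        · exact Or.inl ⟨i, h, rfl⟩
        · exact Or.inr ⟨2 * (i - j), Or.inl ⟨i - j, by omega, rfl⟩, by omega⟩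
      · exact Or.inr ⟨s + 2 * k, Or.inr ⟨s, hs, rfl⟩, by ring⟩
  rw [key, key, add_comm]

lemma evShift_injective (k : ℕ) : Function.Injective (evShift k) := by
  have key {S T : Finset ℕ} (h : evShift k S = evShift k T) : S ⊆ T := by
    intro s hs
    have : s + 2 * k ∈ evShift k T := h ▸ mem_evShift.2 (Or.inr ⟨s, hs, rfl⟩)
    rcases mem_evShift.1 this with ⟨i, hi, h'⟩ | ⟨t, ht, h'⟩
    · omega
    · exact (by omega : t = s) ▸ ht
  exact fun S T h => (key h).antisymm (key h.symm)

lemma cntBelow_bShift_of_lt {k i : ℕ} (A : Finset ℕ) (hi : i < k) :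
    cntBelow (bShift k A) i = i := by
  have : (bShift k A).filter (· < i) = Finset.range i := by
    ext x
    simp only [bShift, Finset.mem_filter, Finset.mem_union, Finset.mem_range, Finset.mem_image]
    exact ⟨fun h => h.2, fun h => ⟨Or.inl (by omega), h⟩⟩
  rw [cntBelow, this, Finset.card_range]

lemma cntBelow_bShift_add (k a : ℕ) (A : Finset ℕ) :
    cntBelow (bShift k A) (a + k) = cntBelow A a + k := by
  have : (bShift k A).filter (· < a + k) =
      (A.filter (· < a)).image (· + k) ∪ Finset.range k := by
    ext x
    simp only [bShift, Finset.mem_filter, Finset.mem_union, Finset.mem_range, Finset.mem_image]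
    constructor
    · rintro ⟨h | ⟨b, hb, rfl⟩, h'⟩
      · exact Or.inr h
      · exact Or.inl ⟨b, ⟨hb, by omega⟩, rfl⟩
    · rintro (⟨b, ⟨hb, hlt⟩, rfl⟩ | h)
      · exact ⟨Or.inr ⟨b, hb, rfl⟩, by omega⟩
      · exact ⟨Or.inl h, by omega⟩
  rw [cntBelow, this, Finset.card_union_of_disjoint,
    Finset.card_image_of_injective _ (add_left_injective _), Finset.card_range, cntBelow]
  simp only [Finset.disjoint_left, Finset.mem_image, Finset.mem_range]
  rintro x ⟨b, -, rfl⟩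
  omega

lemma spread_bShift (k : ℕ) (A : Finset ℕ) : spread (bShift k A) = evShift k (spread A) := by
  ext x
  simp only [mem_evShift, spread, Finset.mem_image]
  constructor
  · rintro ⟨b, hb, rfl⟩
    simp only [bShift, Finset.mem_union, Finset.mem_range, Finset.mem_image] at hb
    rcases hb with hb | ⟨a, ha, rfl⟩
    · exact Or.inl ⟨b, hb, by rw [cntBelow_bShift_of_lt A hb]; ring⟩
    · exact Or.inr ⟨_, ⟨a, ha, rfl⟩, by rw [cntBelow_bShift_add]; ring⟩
  · rintro (⟨i, hi, rfl⟩ | ⟨_, ⟨a, ha, rfl⟩, rfl⟩)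
    · exact ⟨i, by simp [bShift, hi], by rw [cntBelow_bShift_of_lt A hi]; ring⟩
    · exact ⟨a + k, by simp [bShift, ha], by rw [cntBelow_bShift_add]; ring⟩

lemma theta'_eq (Λ : BPair) : theta' Λ = (evShift 1 (spread Λ.1), spread Λ.2) := by
  rw [theta', image_nthEl Λ.1 fun a i => a + i + 2, image_nthEl Λ.2 fun a i => a + i,
    evShift_one, spread, spread, Finset.image_image]
  rfl

lemma theta'_pShift (k : ℕ) (Λ : BPair) : theta' (pShift k Λ) = xShift k (theta' Λ) := by
  simp only [theta'_eq, pShift, xShift, spread_bShift, evShift_evShift_comm 1 k]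

lemma theta'_injective : Function.Injective theta' := by
  intro Λ Ξ h
  rw [theta'_eq, theta'_eq, Prod.mk.injEq] at h
  exact Prod.ext (spread_injective (evShift_injective 1 h.1)) (spread_injective h.2)

lemma card_theta'_fst (Λ : BPair) : (theta' Λ).1.card = Λ.1.card + 1 := by
  rw [theta'_eq, card_evShift, card_spread, add_comm]

lemma card_theta'_snd (Λ : BPair) : (theta' Λ).2.card = Λ.2.card := by
  rw [theta'_eq, card_spread]

lemma cast_choose_two (s : ℕ) : 2 * (s.choose 2 : ℤ) = (s : ℤ) * (s - 1) := by
  have h : ((s.choose 2 : ℕ) : ℚ) = (s : ℚ) * (s - 1) / 2 := Nat.cast_choose_two ℚ s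
  have h2 : 2 * ((s.choose 2 : ℕ) : ℚ) = (s : ℚ) * (s - 1) := by rw [h]; ring
  exact_mod_cast h2

lemma inXtilde_theta' {n : ℤ} {Λ : BPair} (h : inV n 0 Λ) :
    inXtilde (2 * n + 1) (theta' Λ) := by
  obtain ⟨hr, hd⟩ := h
  have hc : (Λ.1.card : ℤ) = Λ.2.card := by simpa [pDefect, sub_eq_zero] using hd
  have hc' : Λ.1.card = Λ.2.card := by exact_mod_cast hc
  simp only [pRank, hd, bRank] at hr
  refine ⟨?_, ?_, ?_⟩
  · rw [theta'_eq]; exact (noConsec_spread _).evShift_one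
  · rw [theta'_eq]; exact noConsec_spread _
  · rw [card_theta'_fst, card_theta'_snd, theta'_eq]
    simp only [sum_evShift_one, sum_spread, card_spread]
    rw [hc'] at hr ⊢
    have := cast_choose_two Λ.2.card
    push_cast
    norm_num at hr
    linear_combination 2 * hr + 4 * this

lemma exists_theta'_eq_xShift {n : ℤ} {Q : BPair} (h : inXtilde (2 * n + 1) Q)
    (hc : Q.1.card = Q.2.card + 1) : ∃ Λ : BPair, inV n 0 Λ ∧ theta' Λ = xShift 1 Q := by
  obtain ⟨h1, h2, hs⟩ := h
  have e1 := h1.spread_compress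
  have e2 := h2.evShift_one.spread_compress
  have c1 : (compress Q.1).card = Q.2.card + 1 := by rw [← card_spread, e1, hc]
  have c2 : (compress (evShift 1 Q.2)).card = Q.2.card + 1 := by
    rw [← card_spread, e2, card_evShift, add_comm]
  have s1 := sum_spread (compress Q.1)
  have s2 := sum_spread (compress (evShift 1 Q.2))
  rw [e1, c1] at s1
  rw [e2, c2, sum_evShift_one] at s2
  refine ⟨(compress Q.1, compress (evShift 1 Q.2)), ⟨?_, by simp [pDefect, c1, c2]⟩, ?_⟩
  · have hch := cast_choose_two (Q.2.card + 1)
    simp only [pRank, bRank, pDefect, c1, c2]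
    rw [hc] at hs
    push_cast at hs hch ⊢
    norm_num
    linarith
  · rw [theta'_eq, e1, e2]; rfl

/-- `Θ'` sends rank-`n` defect-`0` β-pairs into `X̃_{2n+1}` with
defect `1`, is compatible with shifts, and induces a bijection
`𝕍_n^0 → 𝕏_{2n+1}^1`. -/
theorem statement_6 (n : ℕ) :
    (∀ Λ : BPair, inV n 0 Λ →
      inXtilde (2 * n + 1) (theta' Λ) ∧ xDefect (theta' Λ) = 1) ∧
    (∀ Λ : BPair, inV n 0 Λ → theta' (pShift 1 Λ) = xShift 1 (theta' Λ)) ∧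
    (∀ Λ Ξ : BPair, inV n 0 Λ → inV n 0 Ξ →
      (pEquiv Λ Ξ ↔ xEquiv (theta' Λ) (theta' Ξ))) ∧
    (∀ Q : BPair, inXtilde (2 * n + 1) Q → xDefect Q = 1 →
      ∃ Λ : BPair, inV n 0 Λ ∧ xEquiv (theta' Λ) Q) := by
  have hcard {Λ : BPair} (h : inV n 0 Λ) : Λ.1.card = Λ.2.card := by
    have := h.2
    simp only [pDefect] at this
    omega
  have hswap {Λ Ξ : BPair} (hΛ : inV n 0 Λ) (hΞ : inV n 0 Ξ) (k : ℕ) :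
      xShift k (theta' Λ) ≠ (theta' Ξ).swap := by
    intro h
    have f := congrArg (fun P : BPair => P.1.card) h
    have g := congrArg (fun P : BPair => P.2.card) h
    simp only [xShift, Prod.fst_swap, Prod.snd_swap, card_evShift, card_theta'_fst,
      card_theta'_snd] at f g
    have := hcard hΛ
    have := hcard hΞ
    omega
  refine ⟨fun Λ h => ⟨inXtilde_theta' h, ?_⟩, fun Λ _ => theta'_pShift 1 Λ, ?_, ?_⟩
  · rw [xDefect, card_theta'_fst, card_theta'_snd, hcard h]
    simp
  · intro Λ Ξ hΛ hΞ
    refine exists_congr fun k => ?_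
    rw [← theta'_injective.eq_iff, ← theta'_injective.eq_iff (a := Λ), theta'_pShift,
      theta'_pShift]
    constructor
    · rintro (h | h)
      · exact Or.inl h
      · exact Or.inr (Or.inr (Or.inl h))
    · rintro (h | h | h | h)
      · exact Or.inl h
      · exact absurd h (hswap hΛ hΞ k)
      · exact Or.inr h
      · exact absurd h.symm (hswap hΞ hΛ k)
  · intro Q hQ hd
    rw [xDefect, abs_eq zero_le_one] at hd
    rcases hd with hd | hd
    · obtain ⟨Λ, hΛ, h⟩ := exists_theta'_eq_xShift hQ (by omega)
      exact ⟨Λ, hΛ, 1, Or.inr (Or.inr (Or.inl h))⟩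
    · have hQ' : inXtilde (2 * n + 1) Q.swap := by
        refine ⟨hQ.2.1, hQ.1, ?_⟩
        rw [Prod.fst_swap, Prod.snd_swap, add_comm, hQ.2.2, add_comm Q.1.card]
      obtain ⟨Λ, hΛ, h⟩ := exists_theta'_eq_xShift hQ'
        (by simp only [Prod.fst_swap, Prod.snd_swap]; omega)
      refine ⟨Λ, hΛ, 1, Or.inr (Or.inr (Or.inr ?_))⟩
      rw [h]
      rfl

end CSpaper
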